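/- (Hobby–Rice theorem for atomic measures, two-person necklace splitting) Let P₁,...,Pₙ be finite subsets of ℝ with all points distinct. Then there exist n cut points c₁ ≤ ... ≤ cₙ partitioning ℝ into n+1 intervals, alternately labeled + and −, such that for each i, the union of + intervals and the union of − intervals each contain at most ⌊|Pᵢ|/2⌋ points of Pᵢ. -/

import Mathlib

open Finset

/-- The sign of the point `x` when the line is cut at the points `t i` and the leftmost part is
labelled `+`. -/
def cutSign {α ι : Type*} [LinearOrder α] [Fintype ι] (t : ι → α) (x : α) : ℤ :=
  ∏ i, if t i < x then -1 else 1

/-- The sign contributed at `x` by a further cut in the gap whose set of points to the left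
is `L`. -/
def gapSign {α : Type*} [DecidableEq α] (L : Finset α) (x : α) : ℤ :=
  if x ∈ L then 1 else -1

/-- Cutting at `t` and flipping signs by `u` splits every `Q i` evenly, apart from `t i`. -/
def Halves {α ι : Type*} [LinearOrder α] [Fintype ι] (Q : ι → Finset α) (t : ι → α)
    (u : α → ℤ) : Prop :=
  ∀ i, ∑ x ∈ (Q i).erase (t i), cutSign t x * u x = 0

section Signs

variable {α ι : Type*} [LinearOrder α] [Fintype ι]

lemma cutSign_eq (t : ι → α) (x : α) : cutSign t x = 1 ∨ cutSign t x = -1 := by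
  unfold cutSign
  refine Finset.prod_induction _ (fun z : ℤ => z = 1 ∨ z = -1) ?_ (Or.inl rfl) ?_
  · rintro a b (rfl | rfl) (rfl | rfl) <;> simp
  · intro i _
    split_ifs <;> simp

lemma cutSign_eq_neg_one_pow (t : ι → α) (x : α) :
    cutSign t x = (-1) ^ #{i | t i < x} := by
  unfold cutSign
  rw [Finset.prod_ite]
  simp

lemma odd_sum_of_sign {s : Finset α} {v : α → ℤ} (hv : ∀ x, v x = 1 ∨ v x = -1) :
    Odd (∑ x ∈ s, v x) ↔ Odd #s := by
  induction s using Finset.induction_on with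
  | empty => simp
  | insert a s ha ih =>
    have h1 : Odd (v a) := by rcases hv a with h | h <;> rw [h] <;> decide
    rw [sum_insert ha, card_insert_of_notMem ha, Nat.odd_add_one, ← ih, Int.odd_add]
    simp [h1]

lemma cutSign_snoc {n : ℕ} (t : Fin n → α) (b x : α) :
    cutSign (Fin.snoc t b : Fin (n + 1) → α) x = cutSign t x * if b < x then -1 else 1 := by
  unfold cutSign
  rw [Fin.prod_univ_castSucc]
  simp

lemma cutSign_update_mul [DecidableEq ι] (t : ι → α) (d : ι) (b x : α) :
    cutSign (Function.update t d b) x * (if t d < x then -1 else 1) =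
      cutSign t x * if b < x then -1 else 1 := by
  unfold cutSign
  rw [← Finset.mul_prod_erase _ _ (mem_univ d), ← Finset.mul_prod_erase univ (fun i =>
    if t i < x then (-1 : ℤ) else 1) (mem_univ d)]
  have h : ∏ i ∈ univ.erase d, (if Function.update t d b i < x then (-1 : ℤ) else 1) =
      ∏ i ∈ univ.erase d, if t i < x then (-1 : ℤ) else 1 :=
    Finset.prod_congr rfl fun i hi => by
      rw [Function.update_of_ne (Finset.ne_of_mem_erase hi)]
  rw [h, Function.update_self]
  ring

lemma gapSign_filter_lt {S : Finset α} {b x : α} (hx : x ∈ S) (hxb : x ≠ b) :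
    gapSign (S.filter (· < b)) x = if b < x then -1 else 1 := by
  unfold gapSign
  rcases lt_or_gt_of_ne hxb with h | h <;> simp [hx, h, not_lt.2 h.le]

lemma gapSign_filter_le {S : Finset α} {b x : α} (hx : x ∈ S) (hxb : x ≠ b) :
    gapSign (S.filter (· ≤ b)) x = if b < x then -1 else 1 := by
  unfold gapSign
  rcases lt_or_gt_of_ne hxb with h | h <;> simp [hx, h, h.le, not_lt.2 h.le]

lemma gapSign_filter_lt_self (S : Finset α) (b : α) : gapSign (S.filter (· < b)) b = -1 := by
  simp [gapSign]

lemma gapSign_filter_le_self {S : Finset α} {b : α} (hb : b ∈ S) :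
    gapSign (S.filter (· ≤ b)) b = 1 := by
  simp [gapSign, hb]

end Signs

/-- Telescoping along the gaps of a finite linear order, in characteristic two. -/
lemma sum_lowerSets_telescope {α : Type*} [LinearOrder α] (Φ : Finset α → ZMod 2)
    (S : Finset α) :
    ∑ b ∈ S, (Φ (S.filter (· < b)) + Φ (S.filter (· ≤ b))) = Φ ∅ + Φ S := by
  induction S using Finset.induction_on_max with
  | empty => simp [CharTwo.add_self_eq_zero]
  | insert a S ha ih =>
    have haS : a ∉ S := fun h => lt_irrefl a (ha a h)
    have h1 : (insert a S).filter (· < a) = S := by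
      ext x
      simp only [mem_filter, mem_insert]
      grind
    have h2 : (insert a S).filter (· ≤ a) = insert a S := by
      refine Finset.filter_true_of_mem fun x hx => ?_
      rcases mem_insert.1 hx with rfl | hx
      · exact le_rfl
      · exact (ha x hx).le
    have h3 : ∀ b ∈ S, Φ ((insert a S).filter (· < b)) + Φ ((insert a S).filter (· ≤ b)) =
        Φ (S.filter (· < b)) + Φ (S.filter (· ≤ b)) := by
      intro b hb
      have := ha b hb
      rw [Finset.filter_insert, Finset.filter_insert, if_neg this.not_gt, if_neg this.not_ge]
    rw [Finset.sum_insert haS, Finset.sum_congr rfl h3, ih, h1, h2]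
    have := CharTwo.add_self_eq_zero (Φ S)
    linear_combination this

section Step

variable {α : Type*} [LinearOrder α] {n : ℕ}

/-- A gap is admissible if cutting there in addition to `t` halves every `Q i` and leaves a
positive excess on `R`. -/
def Admissible (Q : Fin n → Finset α) (R : Finset α) (t : Fin n → α) (L : Finset α) : Prop :=
  Halves Q t (gapSign L) ∧ 0 < ∑ x ∈ R, cutSign t x * gapSign L x

open Classical in
/-- The indicator of a proposition in characteristic two. -/
noncomputable def ind (p : Prop) : ZMod 2 := if p then 1 else 0

lemma ind_congr {p q : Prop} (h : p ↔ q) : ind p = ind q := by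
  rw [propext h]

lemma ind_add_self (p : Prop) : ind p + ind p = 0 := CharTwo.add_self_eq_zero _

lemma halves_congr {Q : Fin n → Finset α} {t : Fin n → α} {u v : α → ℤ}
    (h : ∀ i, ∀ x ∈ (Q i).erase (t i), u x = v x) : Halves Q t u ↔ Halves Q t v := by
  refine forall_congr' fun i => ?_
  rw [Finset.sum_congr rfl fun x hx => by rw [h i x hx]]

lemma ind_admissible_ends {Q : Fin n → Finset α} {R S : Finset α} (hQ : ∀ i, Q i ⊆ S)
    (hR : R ⊆ S) (hodd : Odd #R) (t : Fin n → α) :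
    ind (Admissible Q R t ∅) + ind (Admissible Q R t S) = ind (Halves Q t 1) := by
  have hS : Halves Q t (gapSign S) ↔ Halves Q t 1 :=
    halves_congr fun i x hx => by simp [gapSign, hQ i (mem_of_mem_erase hx)]
  have h0 : Halves Q t (gapSign ∅) ↔ Halves Q t 1 :=
    forall_congr' fun i => by simp [gapSign]
  have hRS : ∑ x ∈ R, cutSign t x * gapSign S x = ∑ x ∈ R, cutSign t x :=
    Finset.sum_congr rfl fun x hx => by simp [gapSign, hR hx]
  have hR0 : ∑ x ∈ R, cutSign t x * gapSign ∅ x = -∑ x ∈ R, cutSign t x := by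
    simp [gapSign]
  have hne : ∑ x ∈ R, cutSign t x ≠ 0 := by
    intro h
    have := (odd_sum_of_sign (s := R) (cutSign_eq t)).2 hodd
    rw [h] at this
    exact absurd this (by decide)
  unfold Admissible ind
  rw [hS, h0, hRS, hR0]
  by_cases hH : Halves Q t 1
  · rcases lt_or_gt_of_ne hne with h | h
    · simp [hH, h, h.le]
    · simp [hH, h, h.le]
  · simp [hH]

lemma halves_snoc_iff (Q : Fin (n + 1) → Finset α) (t : Fin n → α) (b : α) :
    Halves Q (Fin.snoc t b : Fin (n + 1) → α) 1 ↔
      Halves (fun i => Q i.castSucc) t (fun x => if b < x then -1 else 1) ∧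
        ∑ x ∈ (Q (Fin.last n)).erase b, cutSign t x * (if b < x then -1 else 1) = 0 := by
  unfold Halves
  rw [Fin.forall_fin_succ']
  simp [cutSign_snoc]

/-- Moving the additional cut across a point of the last class changes admissibility exactly when
placing the cut on that point halves all the classes. -/
lemma ind_admissible_last {Q : Fin (n + 1) → Finset α} {S : Finset α} (hQ : ∀ i, Q i ⊆ S)
    (hdisj : ∀ i j, i ≠ j → Disjoint (Q i) (Q j)) (hodd : Odd #(Q (Fin.last n)))
    (t : Fin n → α) {b : α} (hb : b ∈ Q (Fin.last n)) :
    ind (Admissible (fun i => Q i.castSucc) (Q (Fin.last n)) t (S.filter (· < b))) +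
      ind (Admissible (fun i => Q i.castSucc) (Q (Fin.last n)) t (S.filter (· ≤ b))) =
      ind (Halves Q (Fin.snoc t b : Fin (n + 1) → α) 1) := by
  rw [ind_congr (halves_snoc_iff Q t b)]
  have hne : ∀ i : Fin n, ∀ x ∈ (Q i.castSucc).erase (t i), x ≠ b := by
    rintro i x hx rfl
    exact Finset.disjoint_left.1 (hdisj _ _ (Fin.castSucc_lt_last i).ne)
      (mem_of_mem_erase hx) hb
  have hlt := halves_congr (t := t) (Q := fun i => Q i.castSucc) fun i x hx =>
    gapSign_filter_lt (hQ _ (mem_of_mem_erase hx)) (hne i x hx)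
  have hle := halves_congr (t := t) (Q := fun i => Q i.castSucc) fun i x hx =>
    gapSign_filter_le (hQ _ (mem_of_mem_erase hx)) (hne i x hx)
  unfold Admissible
  rw [hlt, hle, ← Finset.add_sum_erase _ _ hb, ← Finset.add_sum_erase _ _ hb,
    gapSign_filter_lt_self, gapSign_filter_le_self (hQ _ hb),
    Finset.sum_congr rfl fun x hx => congrArg (cutSign t x * ·)
      (gapSign_filter_lt (hQ _ (mem_of_mem_erase hx)) (ne_of_mem_erase hx)),
    Finset.sum_congr rfl fun x hx => congrArg (cutSign t x * ·)
      (gapSign_filter_le (hQ _ (mem_of_mem_erase hx)) (ne_of_mem_erase hx))]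
  have heven : Even (∑ x ∈ (Q (Fin.last n)).erase b,
      cutSign t x * (if b < x then -1 else 1)) := by
    rw [← Int.not_odd_iff_even, odd_sum_of_sign, card_erase_of_mem hb, Nat.not_odd_iff_even]
    · exact Nat.Odd.sub_odd hodd odd_one
    · intro x
      rcases cutSign_eq t x with h | h <;> rw [h] <;> split_ifs <;> simp
  generalize ∑ x ∈ (Q (Fin.last n)).erase b, cutSign t x * (if b < x then -1 else 1) = E at *
  obtain ⟨k, rfl⟩ := heven
  by_cases hH : Halves (fun i => Q i.castSucc) t (fun x => if b < x then -1 else 1)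
  · have hk : k < 0 ∨ k = 0 ∨ 0 < k := lt_trichotomy k 0
    unfold ind
    rcases cutSign_eq t b with h | h <;> rw [h] <;> rcases hk with hk | rfl | hk <;>
      simp only [hH, true_and] <;> split_ifs <;> first | omega | simp | rfl
  · simp [ind, hH]

lemma sum_erase_eq_add {s : Finset α} {v w : α → ℤ} {a b : α} (hb : b ∈ s) (hab : b ≠ a)
    (h : ∀ x ∈ (s.erase a).erase b, v x = w x) :
    ∑ x ∈ s.erase a, v x = v b + ∑ x ∈ (s.erase a).erase b, w x := by
  rw [← Finset.add_sum_erase _ _ (mem_erase.2 ⟨hab, hb⟩), Finset.sum_congr rfl h]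

/-- Moving the additional cut across a point `b` of a class `Q d` that is already cut elsewhere
changes admissibility under a condition that is symmetric in `b` and `t d`. -/
lemma ind_admissible_of_ne {Q : Fin n → Finset α} {R S : Finset α} (hQ : ∀ i, Q i ⊆ S)
    (hR : R ⊆ S) (hdisj : ∀ i j, i ≠ j → Disjoint (Q i) (Q j)) (hQR : ∀ i, Disjoint (Q i) R)
    (t : Fin n → α) {d : Fin n} {b : α} (hb : b ∈ Q d) (hbt : b ≠ t d) :
    let v : α → ℤ := fun x => cutSign t x * if b < x then -1 else 1
    let E : ℤ := ∑ x ∈ ((Q d).erase (t d)).erase b, v x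
    ind (Admissible Q R t (S.filter (· < b))) + ind (Admissible Q R t (S.filter (· ≤ b))) =
      ind ((∀ i, i ≠ d → ∑ x ∈ (Q i).erase (t i), v x = 0) ∧ 0 < ∑ x ∈ R, v x ∧
        (E = 1 ∨ E = -1)) := by
  intro v E
  have hneR : ∀ x ∈ R, x ≠ b := by
    rintro x hx rfl
    exact Finset.disjoint_left.1 (hQR d) hb hx
  have hne : ∀ i, i ≠ d → ∀ x ∈ (Q i).erase (t i), x ≠ b := by
    rintro i hi x hx rfl
    exact Finset.disjoint_left.1 (hdisj i d hi) (mem_of_mem_erase hx) hb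
  have key : ∀ L : Finset α, (∀ x ∈ S, x ≠ b → gapSign L x = if b < x then -1 else 1) →
      (Admissible Q R t L ↔ (∀ i, i ≠ d → ∑ x ∈ (Q i).erase (t i), v x = 0) ∧
        0 < ∑ x ∈ R, v x ∧ cutSign t b * gapSign L b + E = 0) := by
    intro L hL
    have hRv : ∑ x ∈ R, cutSign t x * gapSign L x = ∑ x ∈ R, v x :=
      Finset.sum_congr rfl fun x hx => by rw [hL x (hR hx) (hneR x hx)]
    have hv : ∀ i, i ≠ d → ∑ x ∈ (Q i).erase (t i), cutSign t x * gapSign L x =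
        ∑ x ∈ (Q i).erase (t i), v x := fun i hi =>
      Finset.sum_congr rfl fun x hx => by
        rw [hL x (hQ i (mem_of_mem_erase hx)) (hne i hi x hx)]
    have hd : ∑ x ∈ (Q d).erase (t d), cutSign t x * gapSign L x =
        cutSign t b * gapSign L b + E :=
      sum_erase_eq_add hb hbt fun x hx => by
        rw [hL x (hQ d (mem_of_mem_erase (mem_of_mem_erase hx))) (ne_of_mem_erase hx)]
    unfold Admissible Halves
    rw [hRv]
    constructor
    · rintro ⟨h1, h2⟩
      exact ⟨fun i hi => hv i hi ▸ h1 i, h2, hd ▸ h1 d⟩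
    · rintro ⟨h1, h2, h3⟩
      refine ⟨fun i => ?_, h2⟩
      by_cases hi : i = d
      · subst hi
        rw [hd, h3]
      · rw [hv i hi, h1 i hi]
  rw [ind_congr (key _ fun x hx hxb => gapSign_filter_lt hx hxb),
    ind_congr (key _ fun x hx hxb => gapSign_filter_le hx hxb),
    gapSign_filter_lt_self, gapSign_filter_le_self (hQ d hb)]
  generalize (∀ i, i ≠ d → ∑ x ∈ (Q i).erase (t i), v x = 0) = p
  generalize (0 < ∑ x ∈ R, v x) = q
  generalize E = e
  by_cases hp : p <;> by_cases hq : q <;> simp only [hp, hq, true_and, false_and, ind]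
  · rcases cutSign_eq t b with h | h <;> rw [h] <;> split_ifs <;> first | omega | simp
  all_goals simp

lemma ind_admissible_of_eq {Q : Fin n → Finset α} {R S : Finset α} (hQ : ∀ i, Q i ⊆ S)
    (hR : R ⊆ S) (hdisj : ∀ i j, i ≠ j → Disjoint (Q i) (Q j)) (hQR : ∀ i, Disjoint (Q i) R)
    (t : Fin n → α) {d : Fin n} (hb : t d ∈ Q d) :
    ind (Admissible Q R t (S.filter (· < t d))) +
      ind (Admissible Q R t (S.filter (· ≤ t d))) = 0 := by
  have hneR : ∀ x ∈ R, x ≠ t d := by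
    rintro x hx rfl
    exact Finset.disjoint_left.1 (hQR d) hb hx
  have hne : ∀ i, ∀ x ∈ (Q i).erase (t i), x ≠ t d := by
    rintro i x hx rfl
    by_cases hi : i = d
    · subst hi
      exact ne_of_mem_erase hx rfl
    · exact Finset.disjoint_left.1 (hdisj i d hi) (mem_of_mem_erase hx) hb
  have h : Admissible Q R t (S.filter (· < t d)) ↔ Admissible Q R t (S.filter (· ≤ t d)) := by
    unfold Admissible
    rw [halves_congr fun i x hx => (gapSign_filter_lt (hQ i (mem_of_mem_erase hx))
        (hne i x hx)).trans (gapSign_filter_le (hQ i (mem_of_mem_erase hx)) (hne i x hx)).symm,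
      Finset.sum_congr rfl fun x hx => by
        rw [gapSign_filter_lt (hR hx) (hneR x hx), ← gapSign_filter_le (hR hx) (hneR x hx)]]
  rw [ind_congr h, ind_add_self]

/-- The admissibility changes at points of a class that is already cut cancel in pairs, by
exchanging the point with the cut of its class. -/
lemma sum_ind_admissible_class {Q : Fin n → Finset α} {R S : Finset α} (hQ : ∀ i, Q i ⊆ S)
    (hR : R ⊆ S) (hdisj : ∀ i j, i ≠ j → Disjoint (Q i) (Q j)) (hQR : ∀ i, Disjoint (Q i) R)
    (d : Fin n) :
    ∑ p ∈ Fintype.piFinset Q ×ˢ Q d,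
      (ind (Admissible Q R p.1 (S.filter (· < p.2))) +
        ind (Admissible Q R p.1 (S.filter (· ≤ p.2)))) = 0 := by
  refine Finset.sum_involution (fun p _ => (Function.update p.1 d p.2, p.1 d)) ?_ ?_ ?_ ?_
  · rintro ⟨t, b⟩ hp
    simp only [mem_product, Fintype.mem_piFinset] at hp
    by_cases hbt : b = t d
    · subst hbt
      simp only [Function.update_eq_self]
      exact CharTwo.add_self_eq_zero _
    · have h1 := ind_admissible_of_ne hQ hR hdisj hQR t hp.2 hbt
      have h2 := ind_admissible_of_ne hQ hR hdisj hQR (Function.update t d b) (hp.1 d)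
        (by rw [Function.update_self]; exact Ne.symm hbt)
      simp only [cutSign_update_mul, Function.update_self] at h2
      rw [Finset.erase_right_comm] at h2
      have h3 : (∀ i, i ≠ d → ∑ x ∈ (Q i).erase (Function.update t d b i),
            cutSign t x * (if b < x then -1 else 1) = 0) ↔
          ∀ i, i ≠ d → ∑ x ∈ (Q i).erase (t i),
            cutSign t x * (if b < x then -1 else 1) = 0 :=
        forall₂_congr fun i hi => by rw [Function.update_of_ne hi]
      rw [h3] at h2
      simp only at h1 ⊢
      rw [h1, h2]
      exact ind_add_self _
  · rintro ⟨t, b⟩ hp hne heq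
    simp only [mem_product, Fintype.mem_piFinset] at hp
    obtain rfl : t d = b := congrArg Prod.snd heq
    exact hne (ind_admissible_of_eq hQ hR hdisj hQR t hp.2)
  · rintro ⟨t, b⟩ hp
    simp only [mem_product, Fintype.mem_piFinset] at hp ⊢
    refine ⟨fun i => ?_, hp.1 d⟩
    by_cases hi : i = d
    · subst hi
      simpa using hp.2
    · rw [Function.update_of_ne hi]
      exact hp.1 i
  · rintro ⟨t, b⟩ hp
    simp

end Step

/-- For pairwise disjoint classes of odd size, the number of transversals whose points, used as
cuts, halve every class is odd. -/
theorem sum_ind_halves {α : Type*} [LinearOrder α] (n : ℕ) (Q : Fin n → Finset α)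
    (hdisj : ∀ i j, i ≠ j → Disjoint (Q i) (Q j)) (hodd : ∀ i, Odd #(Q i)) :
    ∑ t ∈ Fintype.piFinset Q, ind (Halves Q t 1) = 1 := by
  induction n with
  | zero =>
    have : ∀ t : Fin 0 → α, Halves Q t 1 := fun t i => i.elim0
    simp [ind, this]
  | succ n ih =>
    set Q' : Fin n → Finset α := fun i => Q i.castSucc with hQ'
    set R := Q (Fin.last n) with hR
    set S := univ.biUnion Q with hS
    have hQS : ∀ i, Q i ⊆ S := fun i => Finset.subset_biUnion_of_mem Q (mem_univ i)
    have hdisj' : ∀ i j, i ≠ j → Disjoint (Q' i) (Q' j) := fun i j hij =>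
      hdisj _ _ fun h => hij (Fin.castSucc_injective n h)
    have hQR : ∀ i, Disjoint (Q' i) R := fun i => hdisj _ _ (Fin.castSucc_lt_last i).ne
    have hsnoc : ∑ t ∈ Fintype.piFinset Q, ind (Halves Q t 1) =
        ∑ t ∈ Fintype.piFinset Q', ∑ b ∈ R,
          ind (Halves Q (Fin.snoc t b : Fin (n + 1) → α) 1) := by
      rw [← Finset.sum_product']
      refine Finset.sum_bij' (fun t _ => (Fin.init t, t (Fin.last n)))
        (fun p _ => Fin.snoc p.1 p.2) ?_ ?_ ?_ ?_ ?_
      · intro t ht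
        simp only [mem_product, Fintype.mem_piFinset] at ht ⊢
        exact ⟨fun i => ht _, ht _⟩
      · intro p hp
        simp only [mem_product, Fintype.mem_piFinset] at hp ⊢
        rw [Fin.forall_fin_succ']
        simpa using hp
      · intro t _
        simp
      · intro p _
        simp
      · intro t _
        simp
    have hsplit : ∀ t : Fin n → α,
        ∑ b ∈ S, (ind (Admissible Q' R t (S.filter (· < b))) +
          ind (Admissible Q' R t (S.filter (· ≤ b)))) =
        ∑ d, ∑ b ∈ Q' d, (ind (Admissible Q' R t (S.filter (· < b))) +
            ind (Admissible Q' R t (S.filter (· ≤ b)))) +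
          ∑ b ∈ R, ind (Halves Q (Fin.snoc t b : Fin (n + 1) → α) 1) := by
      intro t
      conv_lhs => rw [hS]
      rw [Finset.sum_biUnion fun i _ j _ hij => hdisj i j hij, Fin.sum_univ_castSucc]
      congr 1
      exact Finset.sum_congr rfl fun b hb =>
        ind_admissible_last hQS hdisj (hodd _) t hb
    have hzero : ∑ t ∈ Fintype.piFinset Q', ∑ d, ∑ b ∈ Q' d,
        (ind (Admissible Q' R t (S.filter (· < b))) +
            ind (Admissible Q' R t (S.filter (· ≤ b)))) = 0 := by
      rw [Finset.sum_comm]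
      refine Finset.sum_eq_zero fun d _ => ?_
      rw [← Finset.sum_product']
      exact sum_ind_admissible_class (fun i => hQS _) (hQS _) hdisj' hQR d
    have htel : ∀ t : Fin n → α,
        ∑ b ∈ S, (ind (Admissible Q' R t (S.filter (· < b))) +
          ind (Admissible Q' R t (S.filter (· ≤ b)))) = ind (Halves Q' t 1) := fun t => by
      rw [sum_lowerSets_telescope fun L => ind (Admissible Q' R t L),
        ind_admissible_ends (fun i => hQS _) (hQS _) (hodd _)]
    rw [hsnoc, ← ih Q' hdisj' fun i => hodd _, ← Finset.sum_congr rfl fun t _ => htel t,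
      Finset.sum_congr rfl fun t _ => hsplit t, Finset.sum_add_distrib, hzero, zero_add]

/-- Pairwise disjoint classes of odd size have a transversal that halves every class. -/
theorem exists_halves {α : Type*} [LinearOrder α] (n : ℕ) (Q : Fin n → Finset α)
    (hdisj : ∀ i j, i ≠ j → Disjoint (Q i) (Q j)) (hodd : ∀ i, Odd #(Q i)) :
    ∃ t : Fin n → α, (∀ i, t i ∈ Q i) ∧ Halves Q t 1 := by
  by_contra! h
  have := sum_ind_halves n Q hdisj hodd
  rw [Finset.sum_eq_zero fun t ht => by simp [ind, h t (Fintype.mem_piFinset.1 ht)]] at this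
  exact zero_ne_one this

lemma card_sign_eq {α : Type*} {s : Finset α} {v : α → ℤ} (hv : ∀ x, v x = 1 ∨ v x = -1)
    (h : ∑ x ∈ s, v x = 0) :
    2 * #(s.filter (v · = 1)) = #s ∧ 2 * #(s.filter (v · = -1)) = #s := by
  have hcongr : s.filter (¬ v · = 1) = s.filter (v · = -1) :=
    Finset.filter_congr fun x _ => by rcases hv x with h | h <;> simp [h]
  have hcard := Finset.card_filter_add_card_filter_not (s := s) (v · = 1)
  rw [← Finset.sum_filter_add_sum_filter_not s (v · = 1), hcongr,
    Finset.sum_congr rfl fun x hx => (mem_filter.1 hx).2,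
    Finset.sum_congr (s₁ := s.filter (v · = -1)) rfl fun x hx => (mem_filter.1 hx).2] at h
  rw [hcongr] at hcard
  simp only [sum_const, nsmul_eq_mul, mul_one, mul_neg] at h
  omega

/-- Disjoint finite sets of reals can be enlarged by at most one point each to disjoint sets of
odd size. -/
lemma exists_odd_superset (n : ℕ) (P : Fin n → Finset ℝ)
    (hdisj : ∀ i j, i ≠ j → Disjoint (P i) (P j)) :
    ∃ Q : Fin n → Finset ℝ, (∀ i j, i ≠ j → Disjoint (Q i) (Q j)) ∧ (∀ i, P i ⊆ Q i) ∧
      ∀ i, #(Q i) = 2 * (#(P i) / 2) + 1 := by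
  obtain ⟨M, hM⟩ := (univ.biUnion P).bddAbove
  have hlt : ∀ i j, ∀ x ∈ P i, x < M + (j : Fin n) + 1 := fun i j x hx => by
    have h1 : x ≤ M := hM (by simpa using ⟨i, hx⟩)
    have h2 : (0 : ℝ) ≤ (j : ℕ) := Nat.cast_nonneg _
    linarith
  have hnot : ∀ i j : Fin n, M + (j : Fin n) + 1 ∉ P i := fun i j h => lt_irrefl _ (hlt i j _ h)
  refine ⟨fun i => if Odd #(P i) then P i else insert (M + i + 1) (P i), ?_, ?_, ?_⟩
  · intro i j hij
    have hne : M + (i : ℕ) + 1 ≠ M + (j : ℕ) + 1 := by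
      intro h
      have : ((i : ℕ) : ℝ) = (j : ℕ) := by linarith
      exact hij (Fin.ext (by exact_mod_cast this))
    have := hdisj i j hij
    dsimp only
    split_ifs <;> simp [hnot, this, hne.symm]
  · intro i
    dsimp only
    split_ifs <;> simp
  · intro i
    dsimp only
    split_ifs with h
    · obtain ⟨k, hk⟩ := h
      omega
    · rw [card_insert_of_notMem (hnot i i)]
      rw [Nat.not_odd_iff_even] at h
      obtain ⟨k, hk⟩ := h
      omega

/-- Hobby–Rice / two-person necklace splitting for atomic measures: for finite sets
`P₁,…,Pₙ ⊆ ℝ` with all points distinct, there are `n` monotone cut points such that,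
labelling the complementary intervals alternately by the parity of the number of cuts
to the left, each label class contains at most `⌊|Pᵢ|/2⌋` points of each `Pᵢ`
(points at a cut belong to neither side). -/
theorem necklace_splitting_two (n : ℕ) (P : Fin n → Finset ℝ)
    (hdisj : ∀ i j, i ≠ j → Disjoint (P i) (P j)) :
    ∃ c : Fin n → ℝ, Monotone c ∧ ∀ i,
      {x ∈ (P i : Set ℝ) | (∀ j, x ≠ c j) ∧
        Even (Set.ncard {j | c j < x})}.ncard ≤ (P i).card / 2 ∧
      {x ∈ (P i : Set ℝ) | (∀ j, x ≠ c j) ∧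
        Odd (Set.ncard {j | c j < x})}.ncard ≤ (P i).card / 2 := by
  obtain ⟨Q, hQdisj, hPQ, hQcard⟩ := exists_odd_superset n P hdisj
  obtain ⟨t, ht, hhalves⟩ := exists_halves n Q hQdisj fun i => ⟨_, hQcard i⟩
  have hcount : ∀ x, {j | (t ∘ Tuple.sort t) j < x}.ncard = #{j | t j < x} := by
    intro x
    rw [← Set.ncard_coe_finset]
    refine Set.ncard_congr (fun j _ => Tuple.sort t j) ?_ ?_ ?_
    · simp
    · intro a b _ _ h
      exact (Tuple.sort t).injective h
    · intro j hj
      exact ⟨(Tuple.sort t).symm j, by simpa using hj, by simp⟩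
  refine ⟨t ∘ Tuple.sort t, Tuple.monotone_sort t, fun i => ?_⟩
  have hne : ∀ x, (∀ j, x ≠ (t ∘ Tuple.sort t) j) → x ≠ t i := fun x hx h =>
    hx ((Tuple.sort t).symm i) (by simpa using h)
  obtain ⟨hpos, hneg⟩ := card_sign_eq (s := (Q i).erase (t i)) (cutSign_eq t)
    (by simpa using hhalves i)
  rw [card_erase_of_mem (ht i), hQcard i] at hpos hneg
  constructor
  · refine le_trans (b := #(((Q i).erase (t i)).filter (cutSign t · = 1))) ?_ (by omega)
    rw [← Set.ncard_coe_finset]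
    refine Set.ncard_le_ncard ?_ (Finset.finite_toSet _)
    rintro x ⟨hx, hxc, heven⟩
    rw [hcount] at heven
    simp only [coe_filter, mem_erase, Set.mem_ofPred_eq]
    exact ⟨⟨hne x hxc, hPQ i hx⟩, by rw [cutSign_eq_neg_one_pow, heven.neg_one_pow]⟩
  · refine le_trans (b := #(((Q i).erase (t i)).filter (cutSign t · = -1))) ?_ (by omega)
    rw [← Set.ncard_coe_finset]
    refine Set.ncard_le_ncard ?_ (Finset.finite_toSet _)
    rintro x ⟨hx, hxc, hodd⟩
    rw [hcount] at hodd
    simp only [coe_filter, mem_erase, Set.mem_ofPred_eq]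
    exact ⟨⟨hne x hxc, hPQ i hx⟩, by rw [cutSign_eq_neg_one_pow, hodd.neg_one_pow]⟩
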